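/- Let N′ be the 2×2 matrix with rows (0, 1), (1, 0). There is no 2×2 complex symmetric matrix P with rows (a, b), (b, d) such that a is a positive real number and P*·N′·P equals the matrix with rows (0, k), (k, 1) for some real number k. -/

import Mathlib

open Matrix Complex

/-- Case (1cii): there is no complex symmetric `P = !![a, b; b, d]` with `a` a positive
real such that `Pᴴ * N' * P = !![0, k; k, 1]` for some real `k`, where
`N' = !![0, 1; 1, 0]`. -/
theorem no_solution_case_1cii :
    ¬ ∃ (a : ℝ) (b d : ℂ) (k : ℝ), 0 < a ∧
      (!![(a : ℂ), b; b, d])ᴴ * !![0, 1; 1, 0] * !![(a : ℂ), b; b, d] =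
        !![0, (k : ℂ); (k : ℂ), 1] := by
  rintro ⟨a, b, d, k, ha, h⟩
  have h₁ := congrArg re (congrFun (congrFun h 0) 0)
  have h₂ := congrArg im (congrFun (congrFun h 0) 1)
  have h₃ := congrArg re (congrFun (congrFun h 1) 1)
  simp [Matrix.mul_apply, Fin.sum_univ_two] at h₁ h₂ h₃
  have hb : b.re = 0 := by
    have : a * b.re = 0 := by linarith
    exact (mul_eq_zero.mp this).resolve_left ha.ne'
  have hd : d.im = 0 := by
    have : a * d.im = 0 := by linarith
    exact (mul_eq_zero.mp this).resolve_left ha.ne'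
  simp [hb, hd] at h₃
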